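/- Let φ be an admissible kernel with log φ strictly concave on (0, ∞), let Kₙ(t) := ∫_{−∞}^{∞} φ(s+t)·φ(s−t)·s^{2n} ds for n ∈ ℕ₀, and let F(x) := ∫_{−∞}^{∞} e^{itx}·φ(t) dt (a real entire function of order less than 2). Then for every n ∈ ℕ₀ and x ∈ ℝ: Lₙ(x; F) = (2·2^{2n}/(2n)!)·∫_{−∞}^{∞} Kₙ(t)·cos(2xt) dt. Moreover, F has only real zeros (i.e. F belongs to the Laguerre–Pólya class) if and only if Kₙ is a positive definite kernel for every n ∈ ℕ₀. -/

import Mathlib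

open ComplexOrder

/-- A function `K : ℝ → ℝ` is an admissible kernel if it is smooth, positive, even,
strictly decreasing on `(0, ∞)`, and all of its derivatives decay like
`exp(−|t|^{2+ε})` for some `ε > 0` as `|t| → ∞`. -/
def AdmissibleKernel (K : ℝ → ℝ) : Prop :=
  ContDiff ℝ (⊤ : ℕ∞) K ∧ (∀ t : ℝ, 0 < K t) ∧ (∀ t : ℝ, K (-t) = K t) ∧
    (∀ t : ℝ, 0 < t → deriv K t < 0) ∧
    ∃ ε : ℝ, 0 < ε ∧ ∀ n : ℕ,
      (iteratedDeriv n K) =O[Filter.cocompact ℝ] fun t => Real.exp (-|t| ^ (2 + ε))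

/-- A continuous function `φ : ℝ → ℝ` is positive definite if every Hermitian form
`∑ⱼ∑ₖ φ(xⱼ − xₖ)·ρⱼ·conj(ρₖ)` is a nonnegative real number. -/
def PosDefKernel (φ : ℝ → ℝ) : Prop :=
  Continuous φ ∧ ∀ (n : ℕ) (x : Fin n → ℝ) (ρ : Fin n → ℂ),
    0 ≤ ∑ j, ∑ k, (φ (x j - x k) : ℂ) * ρ j * (starRingEnd ℂ) (ρ k)

/-- The associated kernel `Kₙ(t) := ∫ φ(s+t)·φ(s−t)·s^{2n} ds`. -/
noncomputable def assocKernel (φ : ℝ → ℝ) (n : ℕ) (t : ℝ) : ℝ :=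
  ∫ s : ℝ, φ (s + t) * φ (s - t) * s ^ (2 * n)

/-- The Fourier transform `F(z) := ∫ e^{itz}·φ(t) dt`, an entire function. -/
noncomputable def fourierF (φ : ℝ → ℝ) (z : ℂ) : ℂ :=
  ∫ t : ℝ, Complex.exp (Complex.I * t * z) * (φ t : ℂ)

/-- The `n`-th generalized Laguerre expression
`Lₙ(x; f) := ∑_{j=0}^{2n} ((−1)^{j+n}/(2n)!)·C(2n,j)·f^{(j)}(x)·f^{(2n−j)}(x)`. -/
noncomputable def Lag (f : ℂ → ℂ) (n : ℕ) (x : ℂ) : ℂ :=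
  ∑ j ∈ Finset.range (2 * n + 1),
    (-1 : ℂ) ^ (j + n) / (Nat.factorial (2 * n)) * (Nat.choose (2 * n) j) *
      iteratedDeriv j f x * iteratedDeriv (2 * n - j) f x


section PartA
open Complex

lemma lag_eq (f : ℂ → ℂ) (hf : Differentiable ℂ f) (n : ℕ) (x : ℂ) :
    Lag f n x = ((Nat.factorial (2 * n) : ℂ))⁻¹ *
      iteratedDeriv (2 * n) (fun y => f (x + I * y) * f (x - I * y)) 0 := by
  have hcd : ∀ k : ℕ, ContDiff ℂ k f := fun k => hf.contDiff
  have h1 : ∀ (c : ℂ) (k : ℕ), iteratedDeriv k (fun y => f (x + c * y)) 0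
      = c ^ k * iteratedDeriv k f x := by
    intro c k
    have hd : ContDiff ℂ k (fun y => f (x + y)) := by
      have := hcd k
      fun_prop
    have := iteratedDeriv_comp_const_mul hd c
    have h2 := congrFun this 0
    simp only [mul_zero] at h2
    rw [h2, iteratedDeriv_comp_const_add]
    simp
  have h2 : ∀ k : ℕ, iteratedDeriv k (fun y => f (x - I * y)) 0
      = (-I) ^ k * iteratedDeriv k f x := by
    intro k
    rw [← h1 (-I) k]
    congr 1
    ext y
    ring_nf
  have hc1 : ContDiff ℂ (2 * n : ℕ) (fun y => f (x + I * y)) := by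
    have := hcd (2 * n)
    fun_prop
  have hc2 : ContDiff ℂ (2 * n : ℕ) (fun y => f (x - I * y)) := by
    have := hcd (2 * n)
    fun_prop
  rw [iteratedDeriv_fun_mul hc1.contDiffAt hc2.contDiffAt, Lag, Finset.mul_sum]
  refine Finset.sum_congr rfl fun j hj => ?_
  rw [h1, h2]
  have hj' : j ≤ 2 * n := by
    have := Finset.mem_range.1 hj
    omega
  have key : (-1 : ℂ) ^ (j + n) = I ^ j * (-I) ^ (2 * n - j) := by
    have e : (-I) ^ (2 * n - j) * (-I) ^ j = (-1 : ℂ) ^ n := by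
      rw [← pow_add, Nat.sub_add_cancel hj', pow_mul]
      simp
    have e2 : (I : ℂ) ^ j = (-1) ^ j * (-I) ^ j := by
      rw [← mul_pow]; simp
    rw [e2, pow_add, ← e]
    ring
  rw [key]
  field_simp

/-- All Taylor coefficients at zero are nonnegative. -/
def NNT (f : ℂ → ℂ) : Prop :=
  Differentiable ℂ f ∧ ∀ k : ℕ, 0 ≤ iteratedDeriv k f 0

lemma NNT.mul {f g : ℂ → ℂ} (hf : NNT f) (hg : NNT g) : NNT (fun y => f y * g y) := by
  refine ⟨hf.1.mul hg.1, fun k => ?_⟩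
  have h1 : ContDiff ℂ k f := hf.1.contDiff
  have h2 : ContDiff ℂ k g := hg.1.contDiff
  rw [iteratedDeriv_fun_mul h1.contDiffAt h2.contDiffAt]
  refine Finset.sum_nonneg fun i _ => ?_
  have h3 : (0 : ℂ) ≤ (k.choose i : ℂ) := by exact_mod_cast Nat.zero_le _
  exact mul_nonneg (mul_nonneg h3 (hf.2 _)) (hg.2 _)

lemma NNT.const {c : ℂ} (hc : 0 ≤ c) : NNT (fun _ => c) := by
  refine ⟨by fun_prop, fun k => ?_⟩
  rw [iteratedDeriv_const]
  split_ifs <;> simp [hc]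

lemma NNT.quad {c d : ℂ} (hc : 0 ≤ c) (hd : 0 ≤ d) : NNT (fun y => c + d * y ^ 2) := by
  refine ⟨by fun_prop, fun k => ?_⟩
  have h1 : ContDiff ℂ k (fun _ : ℂ => c) := by fun_prop
  have h2 : ContDiff ℂ k (fun y : ℂ => d * y ^ 2) := by fun_prop
  rw [iteratedDeriv_fun_add h1.contDiffAt h2.contDiffAt, iteratedDeriv_const_mul_field,
    iteratedDeriv_fun_pow_zero]
  refine add_nonneg ((NNT.const hc).2 k) (mul_nonneg hd ?_)
  split_ifs <;> simp

/-- product over a list of real zeros -/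
noncomputable def zprod (l : List ℝ) (z : ℂ) : ℂ := (l.map (fun a : ℝ => 1 - z / (a : ℂ))).prod

lemma zprod_nil (z : ℂ) : zprod [] z = 1 := by simp [zprod]
lemma zprod_cons (a : ℝ) (l : List ℝ) (z : ℂ) :
    zprod (a :: l) z = (1 - z / (a : ℂ)) * zprod l z := by simp [zprod]
lemma zprod_zero (l : List ℝ) : zprod l 0 = 1 := by
  induction l with
  | nil => simp [zprod]
  | cons a l ih => rw [zprod_cons, ih]; simp
lemma zprod_diff (l : List ℝ) : Differentiable ℂ (zprod l) := by
  induction l with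
  | nil => 
    have : zprod [] = fun _ => 1 := by ext z; simp [zprod]
    rw [this]; fun_prop
  | cons a l ih =>
    have : zprod (a :: l) = fun z => (1 - z / (a : ℂ)) * zprod l z := by ext z; rw [zprod_cons]
    rw [this]; fun_prop

lemma ofReal_nonneg' {r : ℝ} (h : 0 ≤ r) : (0 : ℂ) ≤ (r : ℂ) := by exact_mod_cast h

lemma zprod_nnt (l : List ℝ) (x : ℝ) :
    NNT (fun y => zprod l (x + I * y) * zprod l (x - I * y)) := by
  induction l with
  | nil => simpa [zprod_nil] using NNT.const (c := 1) (by simp)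
  | cons a l ih =>
    have hq : NNT (fun y => (((1 - x / a) ^ 2 : ℝ) : ℂ) + (((1 / a) ^ 2 : ℝ) : ℂ) * y ^ 2) :=
      NNT.quad (ofReal_nonneg' (sq_nonneg _)) (ofReal_nonneg' (sq_nonneg _))
    convert hq.mul ih using 2 with y
    rw [zprod_cons, zprod_cons]
    push_cast
    have : I ^ 2 = -1 := I_sq
    linear_combination (-(1 / (a:ℂ)) ^ 2 * y ^ 2 * zprod l (x + I * y) * zprod l (x - I * y)) * this

/-- elementary Laguerre-Polya function -/
noncomputable def elemLP (A c : ℝ) (l : List ℝ) (z : ℂ) : ℂ := A * exp (c * z) * zprod l z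

lemma elemLP_diff (A c : ℝ) (l : List ℝ) : Differentiable ℂ (elemLP A c l) := by
  have := zprod_diff l
  unfold elemLP
  fun_prop

lemma elemLP_lag (A c : ℝ) (l : List ℝ) (n : ℕ) (x : ℝ) : 0 ≤ Lag (elemLP A c l) n x := by
  rw [lag_eq _ (elemLP_diff A c l)]
  have h0 : (0 : ℂ) ≤ ((A ^ 2 * Real.exp (2 * c * x) : ℝ) : ℂ) := ofReal_nonneg' (by positivity)
  have h := ((NNT.const h0).mul (zprod_nnt l x)).2 (2 * n)
  refine mul_nonneg (by
    have := ofReal_nonneg' (r := ((Nat.factorial (2 * n) : ℝ))⁻¹) (by positivity)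
    push_cast at this
    exact this) ?_
  convert h using 2
  ext y
  have : exp (c * (x + I * y)) * exp (c * (x - I * y)) = exp (2 * c * x) := by
    rw [← exp_add]; ring_nf
  unfold elemLP
  push_cast
  rw [← this]
  ring

end PartA

section PartA2
open Complex Metric

lemma zprod_lower (l : List ℝ) (R : ℝ) (hR : 0 < R) (hl : ∀ a ∈ l, a ≠ 0 ∧ |a| ≤ R)
    (z : ℂ) (hz : ‖z‖ = 3 * R) : (2 : ℝ) ^ l.length ≤ ‖zprod l z‖ := by
  induction l with
  | nil => simp [zprod]
  | cons a l ih =>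
    rw [zprod_cons, norm_mul, List.length_cons, pow_succ, mul_comm]
    have ih' := ih (fun b hb => hl b (by simp [hb]))
    obtain ⟨ha0, haR⟩ := hl a (by simp)
    have h2 : (2 : ℝ) ≤ ‖1 - z / (a : ℂ)‖ := by
      have h3 : ‖z / (a : ℂ)‖ - ‖(1 : ℂ)‖ ≤ ‖1 - z / (a : ℂ)‖ := by
        rw [norm_sub_rev]; exact norm_sub_norm_le _ _
      have h4 : (3 : ℝ) ≤ ‖z / (a : ℂ)‖ := by
        rw [norm_div, hz, norm_real, Real.norm_eq_abs, le_div_iff₀ (abs_pos.2 ha0)]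
        linarith
      rw [norm_one] at h3
      linarith
    exact mul_le_mul h2 ih' (by positivity) (by positivity)

/-- A partial factorization of `F`. -/
def PFact (F : ℂ → ℂ) (R : ℝ) (l : List ℝ) (h : ℂ → ℂ) : Prop :=
  (∀ a ∈ l, a ≠ 0 ∧ |a| ≤ R) ∧ Differentiable ℂ h ∧
    (∀ z, h ((starRingEnd ℂ) z) = (starRingEnd ℂ) (h z)) ∧ ∀ z, F z = zprod l z * h z

lemma PFact.bound {F : ℂ → ℂ} {R : ℝ} {l : List ℝ} {h : ℂ → ℂ} (hp : PFact F R l h)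
    (hR : 0 < R) {M : ℝ} (hM : ∀ z, ‖z‖ = 3 * R → ‖F z‖ ≤ M) (z : ℂ) (hz : ‖z‖ ≤ 3 * R) :
    ‖h z‖ ≤ M / 2 ^ l.length := by
  obtain ⟨hl, hd, hc, hF⟩ := hp
  have hs : ∀ w, ‖w‖ = 3 * R → ‖h w‖ ≤ M / 2 ^ l.length := by
    intro w hw
    rw [le_div_iff₀ (by positivity)]
    have h1 := hM w hw
    rw [hF, norm_mul] at h1
    have h2 := zprod_lower l R hR hl w hw
    nlinarith [norm_nonneg (h w)]
  refine Complex.norm_le_of_forall_mem_frontier_norm_le (U := ball 0 (3 * R)) isBounded_ball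
    hd.diffContOnCl ?_ ?_
  · intro w hw
    rw [frontier_ball _ (by positivity)] at hw
    exact hs w (by simpa using hw)
  · rw [closure_ball _ (by positivity)]
    simpa using hz

lemma PFact.exists {F : ℂ → ℂ} (hF : Differentiable ℂ F) (hF0 : F 0 ≠ 0)
    (hconj : ∀ z, F ((starRingEnd ℂ) z) = (starRingEnd ℂ) (F z))
    (hreal : ∀ z, F z = 0 → z.im = 0) {R : ℝ} (hR : 0 < R) :
    ∃ l h, PFact F R l h ∧ ∀ z, ‖z‖ ≤ R → h z ≠ 0 := by
  by_contra! hcon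
  have key : ∀ N : ℕ, ∃ l h, PFact F R l h ∧ l.length = N := by
    intro N
    induction N with
    | zero =>
      exact ⟨[], F, ⟨by simp, hF, hconj, by simp [zprod]⟩, rfl⟩
    | succ N ih =>
      obtain ⟨l, h, hp, hlen⟩ := ih
      obtain ⟨z, hz, hz0⟩ := hcon l h hp
      obtain ⟨hl, hd, hc, hfac⟩ := hp
      have hFz : F z = 0 := by rw [hfac, hz0, mul_zero]
      have him := hreal z hFz
      obtain ⟨a, rfl⟩ : ∃ a : ℝ, z = a := ⟨z.re, by apply Complex.ext <;> simp [him]⟩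
      have ha0 : a ≠ 0 := by
        rintro rfl
        exact hF0 (by simpa using hFz)
      have hh : ∀ w, h w = (w - a) * dslope h a w := by
        intro w
        have := sub_smul_dslope h (a : ℂ) w
        rw [smul_eq_mul, hz0, sub_zero] at this
        exact this.symm
      have hdd : Differentiable ℂ (dslope h a) := by
        rw [← differentiableOn_univ]
        exact (Complex.differentiableOn_dslope Filter.univ_mem).2 hd.differentiableOn
      refine ⟨a :: l, fun w => -a * dslope h a w, ⟨?_, ?_, ?_, ?_⟩, by simp [hlen]⟩
      · intro b hb
        rcases List.mem_cons.1 hb with rfl | hb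
        · exact ⟨ha0, by simpa using hz⟩
        · exact hl b hb
      · fun_prop
      ·
        have hds : ∀ w, w ≠ (a : ℂ) → dslope h a w = h w / (w - a) := by
          intro w hw
          rw [hh w]
          field_simp [sub_ne_zero.2 hw]
        have e : ∀ w, dslope h a ((starRingEnd ℂ) w) = (starRingEnd ℂ) (dslope h a w) := by
          have hd1 : Continuous fun w => dslope h a ((starRingEnd ℂ) w) :=
            hdd.continuous.comp continuous_conj
          have hd2 : Continuous fun w => (starRingEnd ℂ) (dslope h a w) :=
            continuous_conj.comp hdd.continuous
          have := hd1.ext_on (s := {(a : ℂ)}ᶜ) (dense_compl_singleton _) hd2 ?_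
          · exact fun w => congrFun this w
          · intro w hw
            have hw : w ≠ (a : ℂ) := hw
            have hw' : (starRingEnd ℂ) w ≠ (a : ℂ) := by
              intro h'
              apply hw
              have := congrArg (starRingEnd ℂ) h'
              simpa using this
            simp only
            rw [hds _ hw, hds _ hw', hc]
            simp
        intro w
        simp [e]
      · intro w
        rw [zprod_cons, hfac, hh w]
        have : (a : ℂ) ≠ 0 := by exact_mod_cast ha0
        field_simp
        ring
  have hcomp : IsCompact (sphere (0 : ℂ) (3 * R)) := isCompact_sphere _ _
  obtain ⟨M, hM⟩ := hcomp.exists_bound_of_continuousOn hF.continuous.continuousOn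
  have hM' : ∀ z, ‖z‖ = 3 * R → ‖F z‖ ≤ M := fun z hz => hM z (by simpa using hz)
  have hpos : 0 < ‖F 0‖ := norm_pos_iff.2 hF0
  obtain ⟨N, hN⟩ := pow_unbounded_of_one_lt (M / ‖F 0‖) (one_lt_two : (1 : ℝ) < 2)
  obtain ⟨l, h, hp, hlen⟩ := key N
  have hb := hp.bound hR hM' 0 (by simp; positivity)
  have h0 : F 0 = h 0 := by rw [hp.2.2.2, zprod_zero, one_mul]
  rw [← h0, hlen, le_div_iff₀ (by positivity)] at hb
  rw [div_lt_iff₀ hpos] at hN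
  linarith

lemma exists_log_ball {h : ℂ → ℂ} (hd : Differentiable ℂ h) {R : ℝ} (hR : 0 < R)
    (hne : ∀ z ∈ ball (0 : ℂ) R, h z ≠ 0) :
    ∃ g : ℂ → ℂ, g 0 = 0 ∧ (∀ z ∈ ball (0 : ℂ) R, HasDerivAt g (deriv h z / h z) z) ∧
      ∀ z ∈ ball (0 : ℂ) R, h z = h 0 * exp (g z) := by
  have h1 : DifferentiableOn ℂ (fun z => deriv h z / h z) (ball 0 R) := by
    intro z hz
    have h2 : DifferentiableAt ℂ (deriv h) z :=
      (hd.contDiff (n := 2)).differentiable_deriv_two z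
    exact (h2.div (hd z) (hne z hz)).differentiableWithinAt
  obtain ⟨g, hg0, hg⟩ := h1.isExactOn_ball.with_val_at 0 0
  refine ⟨g, hg0, hg, ?_⟩
  have hder : ∀ z ∈ ball (0 : ℂ) R, HasDerivAt (fun w => h w * exp (-g w)) 0 z := by
    intro z hz
    have := (hd z).hasDerivAt.mul ((hg z hz).neg.cexp)
    refine HasDerivAt.congr_deriv this ?_
    have e : h z * (deriv h z / h z) = deriv h z := mul_div_cancel₀ _ (hne z hz)
    show deriv h z * exp (-g z) + h z * (exp (-g z) * -(deriv h z / h z)) = 0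
    linear_combination - exp (-g z) * e
  intro z hz
  have hconst := (convex_ball (0 : ℂ) R).is_const_of_fderivWithin_eq_zero (𝕜 := ℂ)
    (f := fun w => h w * exp (-g w))
    (fun w hw => (hder w hw).differentiableAt.differentiableWithinAt) ?_ hz (mem_ball_self hR)
  · simp only [hg0, neg_zero, exp_zero, mul_one] at hconst
    rw [← hconst, mul_assoc, ← exp_add]
    simp
  · intro w hw
    have := (hder w hw).hasFDerivAt.hasFDerivWithinAt (s := ball (0 : ℂ) R)
    rw [this.fderivWithin (isOpen_ball.uniqueDiffWithinAt hw)]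
    ext
    simp

lemma second_order {g : ℂ → ℂ} {R B : ℝ} (hR : 0 < R) (hd : DifferentiableOn ℂ g (ball 0 (2 * R)))
    (hg0 : g 0 = 0) (hB : ∀ z, ‖z‖ ≤ R → ‖g z‖ ≤ B) (z : ℂ) (hz : ‖z‖ ≤ R) :
    ‖g z - deriv g 0 * z‖ ≤ 2 * B * ‖z‖ ^ 2 / R ^ 2 := by
  have hnhds : ball (0 : ℂ) (2 * R) ∈ nhds (0 : ℂ) := ball_mem_nhds _ (by positivity)
  have hd1 : DifferentiableOn ℂ (dslope g 0) (ball 0 (2 * R)) :=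
    (Complex.differentiableOn_dslope hnhds).2 hd
  have hd2 : DifferentiableOn ℂ (dslope (dslope g 0) 0) (ball 0 (2 * R)) :=
    (Complex.differentiableOn_dslope hnhds).2 hd1
  set q := dslope (dslope g 0) 0 with hq
  have hfac : ∀ w, g w - deriv g 0 * w = w ^ 2 * q w := by
    intro w
    have e1 := sub_smul_dslope g 0 w
    have e2 := sub_smul_dslope (dslope g 0) 0 w
    rw [dslope_same] at e2
    simp only [sub_zero, smul_eq_mul, hg0] at e1 e2
    rw [← hq] at e2
    linear_combination w * (-e2) - e1
  have hsub : closedBall (0 : ℂ) R ⊆ ball 0 (2 * R) := closedBall_subset_ball (by linarith)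
  have hc : ‖deriv g 0‖ ≤ B / R := by
    refine Complex.norm_deriv_le_of_forall_mem_sphere_norm_le hR ?_ ?_
    · refine DifferentiableOn.diffContOnCl ?_
      rw [closure_ball _ hR.ne']
      exact hd.mono hsub
    · intro w hw
      exact hB w (le_of_eq (by simpa using hw))
  have hqb : ‖q z‖ ≤ 2 * B / R ^ 2 := by
    refine Complex.norm_le_of_forall_mem_frontier_norm_le (U := ball 0 R) isBounded_ball
      (DifferentiableOn.diffContOnCl ?_) ?_ ?_
    · rw [closure_ball _ hR.ne']
      exact hd2.mono hsub
    · intro w hw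
      rw [frontier_ball _ hR.ne'] at hw
      have hw : ‖w‖ = R := by simpa using hw
      have h1 : ‖w ^ 2 * q w‖ ≤ B + B / R * R := by
        rw [← hfac]
        refine (norm_sub_le _ _).trans (add_le_add (hB w hw.le) ?_)
        rw [norm_mul, hw]
        gcongr
      rw [norm_mul, norm_pow, hw] at h1
      rw [le_div_iff₀ (by positivity)]
      have : B / R * R = B := by field_simp
      linarith
    · rw [closure_ball _ hR.ne']
      simpa using hz
  rw [hfac, norm_mul, norm_pow]
  calc ‖z‖ ^ 2 * ‖q z‖ ≤ ‖z‖ ^ 2 * (2 * B / R ^ 2) := by gcongr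
    _ = _ := by ring

lemma approx_step {F : ℂ → ℂ} (hF : Differentiable ℂ F) {F0 : ℝ} (hF0 : F 0 = F0) (hF0' : 0 < F0)
    (hconj : ∀ z, F ((starRingEnd ℂ) z) = (starRingEnd ℂ) (F z))
    (hreal : ∀ z, F z = 0 → z.im = 0) {R : ℝ} (hR : 0 < R) {M : ℝ}
    (hM : ∀ z, ‖z‖ = 3 * (2 * R) → ‖F z‖ ≤ M) :
    ∃ (c : ℝ) (l : List ℝ), ∀ z, ‖z‖ ≤ R → ∃ k : ℂ, elemLP F0 c l z = F z * exp k ∧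
      ‖k‖ ≤ 4 * (Real.log (M / F0) + 1) * ‖z‖ ^ 2 / R ^ 2 := by
  have h0ne : F 0 ≠ 0 := by rw [hF0]; exact_mod_cast hF0'.ne'
  obtain ⟨l, h, hp, hne⟩ := PFact.exists hF h0ne hconj hreal (R := 2 * R) (by positivity)
  have hh0 : h 0 = F0 := by rw [← hF0, hp.2.2.2, zprod_zero, one_mul]
  have hbd : ∀ z, ‖z‖ ≤ 2 * R → ‖h z‖ ≤ M := by
    intro z hz
    have hb := hp.bound (by positivity) hM z (by linarith)
    have hMn : 0 ≤ M := by
      refine (norm_nonneg _).trans (hM ((3 * (2 * R) : ℝ) : ℂ) ?_)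
      rw [norm_real, Real.norm_of_nonneg (by positivity)]
    refine hb.trans (div_le_self hMn (one_le_pow₀ one_le_two))
  have hMF : F0 ≤ M := by
    have := hbd 0 (by simp; positivity)
    rwa [hh0, norm_real, Real.norm_of_nonneg hF0'.le] at this
  obtain ⟨g, hg0, hgd, hge⟩ := exists_log_ball hp.2.1 (R := 2 * R) (by positivity)
    (fun z hz => hne z (by simpa using (mem_ball_zero_iff.1 hz).le))
  have hgdiff : DifferentiableOn ℂ g (ball 0 (2 * R)) :=
    fun z hz => (hgd z hz).differentiableAt.differentiableWithinAt
  have hlog0 : 0 ≤ Real.log (M / F0) := Real.log_nonneg (by rw [le_div_iff₀ hF0']; linarith)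
  have hre : Set.MapsTo g (ball 0 (2 * R)) {z | z.re ≤ Real.log (M / F0) + 1} := by
    intro z hz
    have h1 := hge z hz
    have h2 := hbd z (mem_ball_zero_iff.1 hz).le
    rw [h1, norm_mul, hh0, norm_real, Real.norm_of_nonneg hF0'.le, norm_exp] at h2
    have h3 : Real.exp (g z).re ≤ M / F0 := by rw [le_div_iff₀ hF0']; linarith
    have h4 := (Real.le_log_iff_exp_le (lt_of_lt_of_le (Real.exp_pos _) h3)).2 h3
    show (g z).re ≤ _
    linarith
  have hB : ∀ z, ‖z‖ ≤ R → ‖g z‖ ≤ 2 * (Real.log (M / F0) + 1) := by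
    intro z hz
    have hzb : z ∈ ball (0 : ℂ) (2 * R) := by rw [mem_ball_zero_iff]; linarith
    refine (borelCaratheodory_zero (by linarith) hgdiff hre (by positivity) hzb hg0).trans ?_
    rw [div_le_iff₀ (by linarith)]
    have : ‖z‖ ≤ 2 * R - ‖z‖ := by linarith
    gcongr
  have hder0 : deriv g 0 = deriv h 0 / h 0 := (hgd 0 (mem_ball_self (by positivity))).deriv
  have hcreal : ∃ c : ℝ, deriv g 0 = c := by
    have e := congrFun (deriv_conj_conj (f := h)) 0
    have e2 : (starRingEnd ℂ) ∘ h ∘ (starRingEnd ℂ) = h := by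
      ext w
      simp [hp.2.2.1]
    rw [e2] at e
    simp only [Function.comp_apply, map_zero] at e
    obtain ⟨r, hr⟩ := Complex.conj_eq_iff_real.1 e.symm
    exact ⟨r / F0, by rw [hder0, hr, hh0]; push_cast; rfl⟩
  obtain ⟨c, hc⟩ := hcreal
  refine ⟨c, l, fun z hz => ⟨-(g z - deriv g 0 * z), ?_, ?_⟩⟩
  · have hzb : z ∈ ball (0 : ℂ) (2 * R) := by rw [mem_ball_zero_iff]; linarith
    rw [hp.2.2.2 z, hge z hzb, hh0, elemLP, hc]
    have : exp (c * z) = exp (g z) * exp (-(g z - c * z)) := by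
      rw [← exp_add]; ring_nf
    rw [this]
    ring
  · rw [norm_neg]
    refine (second_order hR hgdiff hg0 hB z hz).trans (le_of_eq (by ring))

lemma approx_LP {F : ℂ → ℂ} (hF : Differentiable ℂ F) {F0 : ℝ} (hF0 : F 0 = F0) (hF0' : 0 < F0)
    (hconj : ∀ z, F ((starRingEnd ℂ) z) = (starRingEnd ℂ) (F z))
    (hreal : ∀ z, F z = 0 → z.im = 0)
    (hgrow : ∀ δ : ℝ, 0 < δ → ∃ C : ℝ, ∀ z, ‖F z‖ ≤ C * Real.exp (δ * ‖z‖ ^ 2))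
    (r η : ℝ) (hr : 0 < r) (hη : 0 < η) :
    ∃ (c : ℝ) (l : List ℝ), ∀ z, ‖z‖ ≤ r → ‖elemLP F0 c l z - F z‖ ≤ η := by
  obtain ⟨B, hB⟩ := (isCompact_closedBall (0 : ℂ) r).exists_bound_of_continuousOn
    hF.continuous.continuousOn
  have hB0 : 0 ≤ B := (norm_nonneg _).trans (hB 0 (by simp [hr.le]))
  set κ := min 1 (η / (2 * (B + 1))) with hκ
  have hκ0 : 0 < κ := by positivity
  set δ := κ / (4 * r ^ 2 * 72) with hδ
  have hδ0 : 0 < δ := by positivity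
  obtain ⟨C, hC⟩ := hgrow δ hδ0
  have hC0 : 0 < C := by
    have := hC 0
    rw [hF0, norm_real, Real.norm_of_nonneg hF0'.le] at this
    simp at this
    linarith
  set L := Real.log (C / F0) + 1 with hL
  obtain ⟨R, hR1, hR2, hR3⟩ : ∃ R : ℝ, 0 < R ∧ r ≤ R ∧ 4 * L * r ^ 2 ≤ κ / 2 * R ^ 2 := by
    refine ⟨r + 1 + 8 * |L| * r ^ 2 / κ, by positivity, ?_, ?_⟩
    · have : 0 ≤ 8 * |L| * r ^ 2 / κ := by positivity
      linarith
    · have h1 : 0 ≤ 8 * |L| * r ^ 2 / κ := by positivity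
      set R := r + 1 + 8 * |L| * r ^ 2 / κ with hRdef
      have h2 : 8 * |L| * r ^ 2 / κ ≤ R ^ 2 := by nlinarith
      have h3 : 8 * |L| * r ^ 2 ≤ κ * R ^ 2 := by
        rw [div_le_iff₀ hκ0] at h2; linarith
      have h4 : L * r ^ 2 ≤ |L| * r ^ 2 := by gcongr; exact le_abs_self L
      linarith
  obtain ⟨c, l, hcl⟩ := approx_step hF hF0 hF0' hconj hreal hR1
    (M := C * Real.exp (δ * (3 * (2 * R)) ^ 2)) (fun z hz => by rw [← hz]; exact hC z)
  refine ⟨c, l, fun z hz => ?_⟩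
  obtain ⟨k, hk1, hk2⟩ := hcl z (hz.trans hR2)
  have hlog : Real.log (C * Real.exp (δ * (3 * (2 * R)) ^ 2) / F0) + 1 = L + 36 * δ * R ^ 2 := by
    rw [mul_div_right_comm, Real.log_mul (by positivity) (by positivity), Real.log_exp, hL]
    ring
  rw [hlog] at hk2
  have hkκ : ‖k‖ ≤ κ := by
    by_cases hneg : L + 36 * δ * R ^ 2 ≤ 0
    · refine hk2.trans (le_trans ?_ hκ0.le)
      refine div_nonpos_of_nonpos_of_nonneg ?_ (by positivity)
      nlinarith [sq_nonneg ‖z‖]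
    · push Not at hneg
      refine hk2.trans ?_
      rw [div_le_iff₀ (by positivity)]
      calc 4 * (L + 36 * δ * R ^ 2) * ‖z‖ ^ 2 ≤ 4 * (L + 36 * δ * R ^ 2) * r ^ 2 := by gcongr
        _ = 4 * L * r ^ 2 + κ / 2 * R ^ 2 := by
            rw [hδ]; field_simp; ring
        _ ≤ κ * R ^ 2 := by linarith
  have hk1' : ‖k‖ ≤ 1 := hkκ.trans (min_le_left _ _)
  have : elemLP F0 c l z - F z = F z * (exp k - 1) := by rw [hk1]; ring
  rw [this, norm_mul]
  calc ‖F z‖ * ‖exp k - 1‖ ≤ B * (2 * κ) := by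
        gcongr
        · exact hB z (by simpa using hz)
        · exact (Complex.norm_exp_sub_one_le hk1').trans (by gcongr)
    _ ≤ B * (2 * (η / (2 * (B + 1)))) := by gcongr; exact min_le_right _ _
    _ = η * (B / (B + 1)) := by field_simp
    _ ≤ η * 1 := by gcongr; rw [div_le_one (by positivity)]; linarith
    _ = η := mul_one η

lemma lag_nonneg_of_real_zeros {F : ℂ → ℂ} (hF : Differentiable ℂ F) {F0 : ℝ} (hF0 : F 0 = F0)
    (hF0' : 0 < F0)
    (hconj : ∀ z, F ((starRingEnd ℂ) z) = (starRingEnd ℂ) (F z))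
    (hreal : ∀ z, F z = 0 → z.im = 0)
    (hgrow : ∀ δ : ℝ, 0 < δ → ∃ C : ℝ, ∀ z, ‖F z‖ ≤ C * Real.exp (δ * ‖z‖ ^ 2))
    (n : ℕ) (x : ℝ) : 0 ≤ Lag F n x := by
  choose c l hcl using fun m : ℕ => approx_LP hF hF0 hF0' hconj hreal hgrow (m + 1) (1 / (m + 1))
    (by positivity) (by positivity)
  set H : ℕ → ℂ → ℂ := fun m => elemLP F0 (c m) (l m) with hH
  have hconv : TendstoLocallyUniformlyOn H F Filter.atTop Set.univ := by
    rw [tendstoLocallyUniformlyOn_iff_forall_isCompact isOpen_univ]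
    intro K _ hK
    rw [Metric.tendstoUniformlyOn_iff]
    intro ε hε
    obtain ⟨b, hb⟩ := hK.isBounded.exists_norm_le
    obtain ⟨m1, hm1⟩ := exists_nat_ge b
    obtain ⟨m2, hm2⟩ := exists_nat_one_div_lt hε
    filter_upwards [Filter.eventually_ge_atTop (max m1 m2)] with m hm w hw
    have hm1' : (m1 : ℝ) ≤ m := by exact_mod_cast (le_max_left _ _).trans hm
    have hm2' : (m2 : ℝ) ≤ m := by exact_mod_cast (le_max_right _ _).trans hm
    rw [dist_comm, dist_eq_norm]
    refine (hcl m w ((hb w hw).trans (by linarith))).trans_lt (lt_of_le_of_lt ?_ hm2)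
    gcongr
  have hiter : ∀ j : ℕ, TendstoLocallyUniformlyOn (fun m => iteratedDeriv j (H m))
      (iteratedDeriv j F) Filter.atTop Set.univ := by
    intro j
    induction j with
    | zero => simpa using hconv
    | succ j ih =>
      have := ih.deriv (Filter.Eventually.of_forall fun m => ?_) isOpen_univ
      · rw [iteratedDeriv_succ]
        convert this using 2 with m
        simp [iteratedDeriv_succ]
      · have h1 : ContDiff ℂ (j + 1 : ℕ) (H m) := (elemLP_diff _ _ _).contDiff
        exact (h1.differentiable_iteratedDeriv j (by exact_mod_cast Nat.lt_succ_self j)).differentiableOn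
  have hpt : ∀ j : ℕ, Filter.Tendsto (fun m => iteratedDeriv j (H m) (x : ℂ)) Filter.atTop
      (nhds (iteratedDeriv j F x)) := fun j => (hiter j).tendsto_at (Set.mem_univ _)
  have hlag : Filter.Tendsto (fun m => Lag (H m) n (x : ℂ)) Filter.atTop (nhds (Lag F n x)) := by
    unfold Lag
    refine tendsto_finsetSum _ fun j _ => ?_
    exact (((hpt j).const_mul _)).mul (hpt _)
  exact ge_of_tendsto' hlag fun m => elemLP_lag _ _ _ _ _

/-- The converse: if all Laguerre expressions are nonnegative then zeros are real. -/
lemma real_zeros_of_lag_nonneg {F : ℂ → ℂ} (hF : Differentiable ℂ F) (hF0 : F 0 ≠ 0)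
    (hconj : ∀ z, F ((starRingEnd ℂ) z) = (starRingEnd ℂ) (F z))
    (hL : ∀ (n : ℕ) (x : ℝ), 0 ≤ Lag F n x) (z : ℂ) (hz : F z = 0) : z.im = 0 := by
  by_contra him
  set x : ℝ := z.re
  set f : ℂ → ℂ := fun y => F (x + I * y) * F (x - I * y) with hf
  have hfd : Differentiable ℂ f := by fun_prop
  have hodd : ∀ k : ℕ, iteratedDeriv (2 * k + 1) f 0 = 0 := by
    intro k
    have h1 := iteratedDeriv_comp_neg (2 * k + 1) f 0
    have h2 : (fun y => f (-y)) = f := by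
      ext y
      simp only [hf]
      ring_nf
    rw [h2] at h1
    simp only [neg_zero, pow_succ, pow_mul] at h1
    simp at h1
    linear_combination h1 / 2
  have heven : ∀ k : ℕ, 0 ≤ iteratedDeriv (2 * k) f 0 := by
    intro k
    have h1 := hL k x
    rw [lag_eq F hF] at h1
    have h2 : (0 : ℂ) ≤ ((Nat.factorial (2 * k) : ℝ) : ℂ) := ofReal_nonneg' (by positivity)
    have h3 := mul_nonneg h2 h1
    rwa [ofReal_natCast, ← mul_assoc, mul_inv_cancel₀ (by exact_mod_cast Nat.factorial_ne_zero _), one_mul] at h3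
  have hall : ∀ k : ℕ, 0 ≤ iteratedDeriv k f 0 := by
    intro k
    rcases Nat.even_or_odd' k with ⟨m, rfl | rfl⟩
    · exact heven m
    · rw [hodd]
  have hf0 : f (|z.im| : ℝ) = 0 := by
    have e1 : (x + I * (z.im : ℂ)) = z := by
      apply Complex.ext <;> simp [x]
    have e2 : (x - I * (z.im : ℂ)) = (starRingEnd ℂ) z := by
      apply Complex.ext <;> simp [x]
    have h0 : F ((starRingEnd ℂ) z) = 0 := by rw [hconj, hz, map_zero]
    simp only [hf]
    rcases abs_choice z.im with h | h <;> rw [h]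
    · rw [e1, hz, zero_mul]
    · push_cast
      rw [mul_neg, sub_neg_eq_add, e1, hz, mul_zero]
  have hsum := Complex.hasSum_taylorSeries_of_entire hfd 0 ((|z.im| : ℝ) : ℂ)
  rw [hf0] at hsum
  have hpos : 0 < |z.im| := abs_pos.2 him
  have hterm : ∀ k : ℕ, iteratedDeriv k f 0 = 0 := by
    intro k
    have hnn : ∀ k : ℕ, (0 : ℂ) ≤ (Nat.factorial k : ℂ)⁻¹ • (((|z.im| : ℝ) : ℂ) - 0) ^ k •
        iteratedDeriv k f 0 := by
      intro k
      have h2 := mul_nonneg (ofReal_nonneg' (r := (Nat.factorial k : ℝ)⁻¹ * |z.im| ^ k)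
        (by positivity)) (hall k)
      push_cast at h2
      simpa [mul_assoc] using h2
    have hre := Complex.hasSum_re hsum
    have hz0 := (hasSum_zero_iff_of_nonneg (fun k => ((Complex.nonneg_iff.1 (hnn k)).1))).1 hre
    have h3 := congrFun hz0 k
    have h4 : (Nat.factorial k : ℂ)⁻¹ • (((|z.im| : ℝ) : ℂ) - 0) ^ k •
        iteratedDeriv k f 0 = 0 := by
      apply Complex.ext
      · simpa using h3
      · exact ((Complex.nonneg_iff.1 (hnn k)).2).symm
    have hne : (((|z.im| : ℝ) : ℂ)) ≠ 0 := by exact_mod_cast hpos.ne'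
    simpa [Nat.factorial_ne_zero, him] using h4
  have hfz : ∀ y, f y = 0 := by
    intro y
    have h := Complex.hasSum_taylorSeries_of_entire hfd 0 y
    simp only [hterm, smul_zero] at h
    exact h.unique hasSum_zero
  have hprod : ∀ w, F w * F (2 * x - w) = 0 := by
    intro w
    have h := hfz (-I * (w - x))
    simp only [hf] at h
    have e1 : (x : ℂ) + I * (-I * (w - x)) = w := by
      linear_combination (-(w - x)) * I_mul_I
    have e2 : (x : ℂ) - I * (-I * (w - x)) = 2 * x - w := by
      linear_combination ((w - x)) * I_mul_I
    rwa [e1, e2] at h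
  have hev : ∀ᶠ w in nhds (0 : ℂ), F (2 * x - w) = 0 := by
    filter_upwards [hF.continuous.continuousAt.eventually_ne hF0] with w hw
    exact (mul_eq_zero.1 (hprod w)).resolve_left hw
  have hG : Differentiable ℂ (fun w => F (2 * x - w)) := by fun_prop
  have hA : AnalyticOnNhd ℂ (fun w => F (2 * x - w)) Set.univ := fun w _ => hG.analyticAt w
  have hzero := hA.eqOn_zero_of_preconnected_of_eventuallyEq_zero isPreconnected_univ
    (Set.mem_univ 0) hev (Set.mem_univ (2 * x : ℂ))
  simp at hzero
  exact hF0 hzero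

end PartA2

section PartB
open MeasureTheory

/-- Super-Gaussian decay. -/
def SG (g : ℝ → ℝ) : Prop :=
  Continuous g ∧ ∀ a : ℝ, ∃ C : ℝ, 0 ≤ C ∧ ∀ t, |g t| ≤ C * Real.exp (-a * t ^ 2)

lemma SG_of_isBigO {g : ℝ → ℝ} (hg : Continuous g) {ε : ℝ} (hε : 0 < ε)
    (h : g =O[Filter.cocompact ℝ] fun t => Real.exp (-|t| ^ (2 + ε))) : SG g := by
  refine ⟨hg, fun a => ?_⟩
  obtain ⟨c, hc⟩ := h.bound
  have h1 : Filter.Tendsto (fun t : ℝ => |t| ^ ε) (Filter.cocompact ℝ) Filter.atTop :=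
    (tendsto_rpow_atTop hε).comp (tendsto_norm_cocompact_atTop (E := ℝ))
  have h2 : ∀ᶠ t in Filter.cocompact ℝ, |g t * Real.exp (a * t ^ 2)| ≤ |c| := by
    have h0 : ∀ᶠ t : ℝ in Filter.cocompact ℝ, t ≠ 0 := by
      have := (isCompact_singleton (x := (0 : ℝ))).compl_mem_cocompact
      filter_upwards [this] with t ht using ht
    filter_upwards [hc, h1.eventually_ge_atTop a, h0] with t ht1 ht2 ht0
    rw [abs_mul, abs_of_pos (Real.exp_pos _)]
    rw [Real.norm_eq_abs, Real.norm_eq_abs, abs_of_pos (Real.exp_pos _)] at ht1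
    have h3 : a * t ^ 2 ≤ |t| ^ (2 + ε) := by
      rw [Real.rpow_add (abs_pos.2 ht0)]
      norm_cast
      rw [sq_abs, mul_comm]
      gcongr
    calc |g t| * Real.exp (a * t ^ 2)
        ≤ (|c| * Real.exp (-|t| ^ (2 + ε))) * Real.exp (|t| ^ (2 + ε)) := by
          gcongr
          exact ht1.trans (by gcongr; exact le_abs_self c)
      _ = |c| := by rw [mul_assoc, ← Real.exp_add]; simp
  obtain ⟨K, hK, hKs⟩ := Filter.mem_cocompact.1 h2
  have hcont : Continuous fun t => g t * Real.exp (a * t ^ 2) := by fun_prop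
  obtain ⟨B, hB⟩ := hK.exists_bound_of_continuousOn hcont.continuousOn
  refine ⟨max |c| B, (abs_nonneg c).trans (le_max_left _ _), fun t => ?_⟩
  have h4 : |g t * Real.exp (a * t ^ 2)| ≤ max |c| B := by
    by_cases ht : t ∈ K
    · exact (hB t ht).trans (le_max_right _ _)
    · exact (hKs ht).trans (le_max_left _ _)
  rw [abs_mul, abs_of_pos (Real.exp_pos _)] at h4
  calc |g t| = (|g t| * Real.exp (a * t ^ 2)) * Real.exp (-a * t ^ 2) := by
        rw [mul_assoc, ← Real.exp_add]; simp
    _ ≤ _ := by gcongr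

lemma pow_exp_bound (k : ℕ) (b : ℝ) : ∃ C : ℝ, 0 ≤ C ∧ ∀ t : ℝ,
    |t| ^ k * Real.exp (b * |t|) ≤ C * Real.exp (t ^ 2) := by
  refine ⟨k.factorial * Real.exp ((b + 1) ^ 2 / 4), by positivity, fun t => ?_⟩
  have h1 : |t| ^ k ≤ k.factorial * Real.exp |t| := by
    have := Real.pow_div_factorial_le_exp |t| (abs_nonneg t) k
    rw [div_le_iff₀ (by positivity)] at this
    linarith
  calc |t| ^ k * Real.exp (b * |t|) ≤ k.factorial * Real.exp |t| * Real.exp (b * |t|) := by gcongr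
    _ = k.factorial * Real.exp ((b + 1) * |t|) := by rw [mul_assoc, ← Real.exp_add]; ring_nf
    _ ≤ k.factorial * Real.exp ((b + 1) ^ 2 / 4 + t ^ 2) := by
        gcongr
        nlinarith [sq_nonneg ((b + 1) / 2 - |t|), sq_abs t]
    _ = _ := by rw [Real.exp_add]; ring

lemma SG.bound {g : ℝ → ℝ} (hg : SG g) (k : ℕ) (b a : ℝ) : ∃ C : ℝ, 0 ≤ C ∧ ∀ t : ℝ,
    |t| ^ k * Real.exp (b * |t|) * |g t| ≤ C * Real.exp (-a * t ^ 2) := by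
  obtain ⟨C1, h1, hC1⟩ := pow_exp_bound k b
  obtain ⟨C2, h2, hC2⟩ := hg.2 (a + 1)
  refine ⟨C1 * C2, by positivity, fun t => ?_⟩
  calc |t| ^ k * Real.exp (b * |t|) * |g t|
      ≤ (C1 * Real.exp (t ^ 2)) * (C2 * Real.exp (-(a + 1) * t ^ 2)) :=
        mul_le_mul (hC1 t) (hC2 t) (abs_nonneg _) (by positivity)
    _ = C1 * C2 * (Real.exp (t ^ 2) * Real.exp (-(a + 1) * t ^ 2)) := by ring
    _ = _ := by rw [← Real.exp_add]; ring_nf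

/-- moment integrands -/
noncomputable def mInt (φ : ℝ → ℝ) (j : ℕ) (z : ℂ) (t : ℝ) : ℂ :=
  (Complex.I * t) ^ j * Complex.exp (Complex.I * t * z) * (φ t : ℂ)

lemma mInt_norm_le (φ : ℝ → ℝ) (j : ℕ) (z : ℂ) (t : ℝ) (b : ℝ) (hb : ‖z‖ ≤ b) :
    ‖mInt φ j z t‖ ≤ |t| ^ j * Real.exp (b * |t|) * |φ t| := by
  unfold mInt
  rw [norm_mul, norm_mul, norm_pow, norm_mul, Complex.norm_I, one_mul, Complex.norm_real,
    Complex.norm_real, Real.norm_eq_abs, Real.norm_eq_abs, Complex.norm_exp]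
  gcongr
  calc (Complex.I * t * z).re ≤ ‖Complex.I * t * z‖ := Complex.re_le_norm _
    _ = |t| * ‖z‖ := by simp
    _ ≤ b * |t| := by rw [mul_comm]; gcongr

lemma mInt_cont {φ : ℝ → ℝ} (hφ : Continuous φ) (j : ℕ) (z : ℂ) : Continuous (mInt φ j z) := by
  unfold mInt
  fun_prop

lemma mInt_integrable {φ : ℝ → ℝ} (hφ : SG φ) (j : ℕ) (z : ℂ) : Integrable (mInt φ j z) := by
  obtain ⟨C, hC0, hC⟩ := hφ.bound j ‖z‖ 1
  refine ((integrable_exp_neg_mul_sq one_pos).const_mul C).mono'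
    (mInt_cont hφ.1 j z).aestronglyMeasurable (Filter.Eventually.of_forall fun t => ?_)
  exact (mInt_norm_le φ j z t _ le_rfl).trans (hC t)

lemma mInt_hasDerivAt {φ : ℝ → ℝ} (hφ : SG φ) (j : ℕ) (z : ℂ) :
    HasDerivAt (fun w => ∫ t, mInt φ j w t) (∫ t, mInt φ (j + 1) z t) z := by
  obtain ⟨C, hC0, hC⟩ := hφ.bound (j + 1) (‖z‖ + 1) 1
  refine (hasDerivAt_integral_of_dominated_loc_of_deriv_le (F := fun w t => mInt φ j w t)
    (F' := fun w t => mInt φ (j + 1) w t)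
    (bound := fun t => C * Real.exp (-1 * t ^ 2)) (Metric.ball_mem_nhds z one_pos)
    (Filter.Eventually.of_forall fun w => (mInt_cont hφ.1 j w).aestronglyMeasurable)
    (mInt_integrable hφ j z) (mInt_cont hφ.1 _ z).aestronglyMeasurable
    (Filter.Eventually.of_forall fun t w hw => ?_)
    ((integrable_exp_neg_mul_sq one_pos).const_mul C)
    (Filter.Eventually.of_forall fun t w hw => ?_)).2
  · refine (mInt_norm_le φ (j + 1) w t _ ?_).trans (hC t)
    have h1 : ‖w - z‖ < 1 := by simpa [dist_eq_norm] using hw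
    have h2 : ‖w‖ ≤ ‖w - z‖ + ‖z‖ := norm_le_norm_sub_add _ _
    linarith
  · unfold mInt
    have h1 : HasDerivAt (fun w : ℂ => Complex.I * t * w) (Complex.I * t) w := by
      simpa using (hasDerivAt_id w).const_mul (Complex.I * t)
    have h2 := ((h1.cexp).const_mul ((Complex.I * t) ^ j)).mul_const (φ t : ℂ)
    refine h2.congr_deriv ?_
    rw [pow_succ]
    ring

lemma fourierF_eq (φ : ℝ → ℝ) : fourierF φ = fun z => ∫ t, mInt φ 0 z t := by
  ext z
  simp [fourierF, mInt]

lemma fourierF_iter {φ : ℝ → ℝ} (hφ : SG φ) (j : ℕ) :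
    iteratedDeriv j (fourierF φ) = fun z => ∫ t, mInt φ j z t := by
  induction j with
  | zero => rw [iteratedDeriv_zero, fourierF_eq]
  | succ j ih =>
    rw [iteratedDeriv_succ, ih]
    ext z
    exact (mInt_hasDerivAt hφ j z).deriv

lemma fourierF_diff {φ : ℝ → ℝ} (hφ : SG φ) : Differentiable ℂ (fourierF φ) := by
  rw [fourierF_eq]
  exact fun z => (mInt_hasDerivAt hφ 0 z).differentiableAt

lemma fourierF_grow {φ : ℝ → ℝ} (hφ : SG φ) (δ : ℝ) (hδ : 0 < δ) :
    ∃ C : ℝ, ∀ z, ‖fourierF φ z‖ ≤ C * Real.exp (δ * ‖z‖ ^ 2) := by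
  obtain ⟨C, hC0, hC⟩ := hφ.2 (1 / (4 * δ) + 1)
  refine ⟨∫ t : ℝ, C * Real.exp (-1 * t ^ 2), fun z => ?_⟩
  rw [fourierF_eq, ← integral_mul_const]
  refine norm_integral_le_of_norm_le
    (((integrable_exp_neg_mul_sq one_pos).const_mul C).mul_const _)
    (Filter.Eventually.of_forall fun t => ?_)
  refine (mInt_norm_le φ 0 z t _ le_rfl).trans ?_
  rw [pow_zero, one_mul]
  calc Real.exp (‖z‖ * |t|) * |φ t|
      ≤ Real.exp (δ * ‖z‖ ^ 2 + 1 / (4 * δ) * t ^ 2) *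
          (C * Real.exp (-(1 / (4 * δ) + 1) * t ^ 2)) := by
        gcongr
        · have h1 : δ * ‖z‖ ^ 2 + 1 / (4 * δ) * t ^ 2 - ‖z‖ * |t|
              = δ * (‖z‖ - |t| / (2 * δ)) ^ 2 := by
            rw [← sq_abs t]; field_simp; ring
          have : 0 ≤ δ * (‖z‖ - |t| / (2 * δ)) ^ 2 := by positivity
          linarith
        · exact hC t
    _ = C * (Real.exp (δ * ‖z‖ ^ 2 + 1 / (4 * δ) * t ^ 2) *
          Real.exp (-(1 / (4 * δ) + 1) * t ^ 2)) := by ring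
    _ = C * (Real.exp (-1 * t ^ 2) * Real.exp (δ * ‖z‖ ^ 2)) := by
        rw [← Real.exp_add, ← Real.exp_add]; ring_nf
    _ = _ := by ring

lemma fourierF_conj {φ : ℝ → ℝ} (heven : ∀ t, φ (-t) = φ t) (z : ℂ) :
    fourierF φ ((starRingEnd ℂ) z) = (starRingEnd ℂ) (fourierF φ z) := by
  unfold fourierF
  rw [← integral_conj]
  rw [← integral_neg_eq_self]
  refine integral_congr_ae (Filter.Eventually.of_forall fun t => ?_)
  simp only [map_mul, ← Complex.exp_conj, Complex.conj_I, Complex.conj_ofReal, heven]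
  push_cast
  ring_nf

lemma fourierF_zero {φ : ℝ → ℝ} (hφ : SG φ) (hpos : ∀ t, 0 < φ t) :
    fourierF φ 0 = ((∫ t, φ t : ℝ) : ℂ) ∧ 0 < ∫ t, φ t := by
  have hφint : Integrable φ := by
    obtain ⟨C, hC0, hC⟩ := hφ.2 1
    exact ((integrable_exp_neg_mul_sq one_pos).const_mul C).mono' hφ.1.aestronglyMeasurable
      (Filter.Eventually.of_forall hC)
  constructor
  · unfold fourierF
    rw [← integral_complex_ofReal]
    simp
  · rw [integral_pos_iff_support_of_nonneg (fun t => (hpos t).le) hφint]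
    have : Function.support φ = Set.univ := by
      ext t; simp [(hpos t).ne']
    rw [this]
    simp

end PartB

section PartB2
open MeasureTheory

lemma gauss2_integrable {f : ℝ → ℝ → ℂ} (hf : Continuous (Function.uncurry f)) {C a : ℝ}
    (ha : 0 < a) (hb : ∀ t u, ‖f t u‖ ≤ C * Real.exp (-a * (t ^ 2 + u ^ 2))) :
    Integrable (Function.uncurry f) (volume.prod volume) := by
  have h1 := ((integrable_exp_neg_mul_sq ha).mul_prod (integrable_exp_neg_mul_sq ha)).const_mul C
  refine h1.mono' hf.aestronglyMeasurable (Filter.Eventually.of_forall fun p => ?_)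
  refine (hb p.1 p.2).trans (le_of_eq ?_)
  rw [← Real.exp_add]
  ring_nf

lemma change_vars {f : ℝ → ℝ → ℂ} (hf : Continuous (Function.uncurry f)) {C a : ℝ} (hC : 0 ≤ C)
    (ha : 0 < a) (hb : ∀ t u, ‖f t u‖ ≤ C * Real.exp (-a * (t ^ 2 + u ^ 2))) :
    ∫ t, ∫ u, f t u = 2 * ∫ v, ∫ s, f (s + v) (v - s) := by
  have h1 : ∀ t, ∫ u, f t u = 2 * ∫ s, f t (t - 2 * s) := by
    intro t
    rw [← integral_sub_left_eq_self (fun u => f t u) volume t]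
    have := Measure.integral_comp_mul_left (fun u => f t (t - u)) 2
    rw [this]
    simp
  have hc1 : Continuous (Function.uncurry fun t s => f t (t - 2 * s)) :=
    hf.comp (f := fun p : ℝ × ℝ => (p.1, p.1 - 2 * p.2)) (by fun_prop)
  have hc2 : Continuous (Function.uncurry fun s v => f (v + s) (v + s - 2 * s)) :=
    hf.comp (f := fun p : ℝ × ℝ => (p.2 + p.1, p.2 + p.1 - 2 * p.1)) (by fun_prop)
  have i1 : Integrable (Function.uncurry fun t s => f t (t - 2 * s)) (volume.prod volume) := by
    refine gauss2_integrable hc1 (C := C) (a := a / 2) (by positivity) fun t s => ?_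
    refine (hb _ _).trans ?_
    gcongr 2
    nlinarith [mul_nonneg ha.le (sq_nonneg (3 * t - 4 * s)), mul_nonneg ha.le (sq_nonneg s), mul_nonneg ha.le (sq_nonneg t)]
  have i2 : Integrable (Function.uncurry fun s v => f (v + s) (v + s - 2 * s))
      (volume.prod volume) := by
    refine gauss2_integrable hc2 (C := C) (a := a) (by positivity) fun t s => ?_
    refine (hb _ _).trans ?_
    gcongr 2
    nlinarith [mul_nonneg ha.le (sq_nonneg s), mul_nonneg ha.le (sq_nonneg t)]
  calc ∫ t, ∫ u, f t u = ∫ t, 2 * ∫ s, f t (t - 2 * s) := by simp_rw [h1]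
    _ = 2 * ∫ t, ∫ s, f t (t - 2 * s) := integral_const_mul _ _
    _ = 2 * ∫ s, ∫ t, f t (t - 2 * s) := by rw [integral_integral_swap i1]
    _ = 2 * ∫ s, ∫ v, f (v + s) (v + s - 2 * s) := by
        congr 2
        ext s
        exact (integral_add_right_eq_self (fun t => f t (t - 2 * s)) s).symm
    _ = 2 * ∫ v, ∫ s, f (v + s) (v + s - 2 * s) := by rw [integral_integral_swap i2]
    _ = _ := by
        congr 4
        ext v
        congr 2
        ext s
        rw [add_comm v s]
        congr 1
        ring

lemma assoc_bound {φ : ℝ → ℝ} (hφ : SG φ) (n : ℕ) : ∃ C, 0 ≤ C ∧ ∀ t s : ℝ,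
    |φ (s + t) * φ (s - t) * s ^ (2 * n)| ≤ C * Real.exp (-1 * (t ^ 2 + s ^ 2)) := by
  obtain ⟨C, hC0, hC⟩ := hφ.2 1
  obtain ⟨D, hD0, hD⟩ := pow_exp_bound (2 * n) 0
  refine ⟨C * C * D, by positivity, fun t s => ?_⟩
  have hD' := hD s
  rw [zero_mul, Real.exp_zero, mul_one] at hD'
  rw [abs_mul, abs_mul, abs_pow]
  calc |φ (s + t)| * |φ (s - t)| * |s| ^ (2 * n)
      ≤ (C * Real.exp (-1 * (s + t) ^ 2)) * (C * Real.exp (-1 * (s - t) ^ 2)) *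
        (D * Real.exp (s ^ 2)) := by
        refine mul_le_mul (mul_le_mul (hC _) (hC _) (abs_nonneg _) (by positivity)) hD'
          (by positivity) (by positivity)
    _ = C * C * D * (Real.exp (-1 * (s + t) ^ 2) * Real.exp (-1 * (s - t) ^ 2) *
        Real.exp (s ^ 2)) := by ring
    _ ≤ _ := by
        rw [← Real.exp_add, ← Real.exp_add]
        gcongr
        nlinarith [sq_nonneg t]

lemma assoc_cont {φ : ℝ → ℝ} (hφ : SG φ) (n : ℕ) : Continuous (assocKernel φ n) := by
  obtain ⟨C, hC0, hC⟩ := assoc_bound hφ n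
  have hc := hφ.1
  refine continuous_of_dominated (F := fun t s => φ (s + t) * φ (s - t) * s ^ (2 * n))
    (bound := fun s => C * Real.exp (-1 * s ^ 2)) (fun t => ?_)
    (fun t => Filter.Eventually.of_forall fun s => ?_)
    ((integrable_exp_neg_mul_sq one_pos).const_mul C)
    (Filter.Eventually.of_forall fun s => ?_)
  · exact Continuous.aestronglyMeasurable (by fun_prop)
  · refine (hC t s).trans ?_
    gcongr 2
    nlinarith [sq_nonneg t]
  · fun_prop

lemma assoc_decay {φ : ℝ → ℝ} (hφ : SG φ) (n : ℕ) : ∃ C, 0 ≤ C ∧ ∀ t : ℝ,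
    |assocKernel φ n t| ≤ C * Real.exp (-1 * t ^ 2) := by
  obtain ⟨C, hC0, hC⟩ := assoc_bound hφ n
  refine ⟨∫ s : ℝ, C * Real.exp (-1 * s ^ 2), integral_nonneg fun s => by positivity, fun t => ?_⟩
  unfold assocKernel
  rw [← integral_mul_const, ← Real.norm_eq_abs]
  refine norm_integral_le_of_norm_le
    (((integrable_exp_neg_mul_sq one_pos).const_mul C).mul_const _)
    (Filter.Eventually.of_forall fun s => ?_)
  refine (hC t s).trans (le_of_eq ?_)
  rw [mul_assoc, ← Real.exp_add]
  ring_nf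

lemma assoc_int {φ : ℝ → ℝ} (hφ : SG φ) (n : ℕ) : Integrable (assocKernel φ n) := by
  obtain ⟨C, hC0, hC⟩ := assoc_decay hφ n
  exact ((integrable_exp_neg_mul_sq one_pos).const_mul C).mono'
    (assoc_cont hφ n).aestronglyMeasurable (Filter.Eventually.of_forall hC)

lemma assoc_even (φ : ℝ → ℝ) (n : ℕ) (t : ℝ) : assocKernel φ n (-t) = assocKernel φ n t := by
  unfold assocKernel
  congr 1
  ext s
  rw [← sub_eq_add_neg, sub_neg_eq_add]
  ring

/-- `∫ K_n(t) e^{2ixt} dt` is `∫ K_n(t) cos(2xt) dt`. -/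
lemma assoc_exp_cos {k : ℝ → ℝ} (hk : Integrable k) (he : ∀ t, k (-t) = k t) (x : ℝ) :
    ∫ t, (k t : ℂ) * Complex.exp (Complex.I * (2 * t * x : ℝ)) =
      ((∫ t, k t * Real.cos (2 * x * t) : ℝ) : ℂ) := by
  have hi : ∀ c : ℝ, Integrable fun t : ℝ =>
      (k t : ℂ) * Complex.exp (Complex.I * (2 * t * c : ℝ)) := by
    intro c
    refine hk.ofReal.mul_bdd (c := 1) (Continuous.aestronglyMeasurable (by fun_prop))
      (Filter.Eventually.of_forall fun t => ?_)
    rw [mul_comm, Complex.norm_exp_ofReal_mul_I]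
  have h1 : ∫ t, (k t : ℂ) * Complex.exp (Complex.I * (2 * t * x : ℝ)) =
      ∫ t, (k t : ℂ) * Complex.exp (Complex.I * (2 * t * (-x) : ℝ)) := by
    rw [← integral_neg_eq_self]
    refine integral_congr_ae (Filter.Eventually.of_forall fun t => ?_)
    simp only [he]
    push_cast
    ring_nf
  have h2 : 2 * ∫ t, (k t : ℂ) * Complex.exp (Complex.I * (2 * t * x : ℝ)) =
      2 * ((∫ t, k t * Real.cos (2 * x * t) : ℝ) : ℂ) := by
    rw [two_mul]
    nth_rewrite 2 [h1]
    rw [← integral_add (hi x) (hi (-x)), ← integral_complex_ofReal, ← integral_const_mul]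
    refine integral_congr_ae (Filter.Eventually.of_forall fun t => ?_)
    simp only
    push_cast
    rw [Complex.cos]
    ring_nf
  exact mul_left_cancel₀ two_ne_zero h2

lemma lag_formula {φ : ℝ → ℝ} (hφ : SG φ) (heven : ∀ t, φ (-t) = φ t) (n : ℕ) (x : ℝ) :
    Lag (fourierF φ) n (x : ℂ) =
        ((2 * 2 ^ (2 * n) / (Nat.factorial (2 * n)) *
          ∫ t : ℝ, assocKernel φ n t * Real.cos (2 * x * t) : ℝ) : ℂ) := by
  set f : ℝ → ℝ → ℂ := fun t u => ((t - u : ℝ) : ℂ) ^ (2 * n) *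
    Complex.exp (Complex.I * ((t + u) * x : ℝ)) * (φ t : ℂ) * (φ u : ℂ) with hfdef
  have hcφ := hφ.1
  have hf : Continuous (Function.uncurry f) := by
    simp only [hfdef, Function.uncurry_def]
    fun_prop
  have hfb : ∃ C, 0 ≤ C ∧ ∀ t u, ‖f t u‖ ≤ C * Real.exp (-1 * (t ^ 2 + u ^ 2)) := by
    obtain ⟨C, hC0, hC⟩ := hφ.2 3
    obtain ⟨D, hD0, hD⟩ := pow_exp_bound (2 * n) 0
    refine ⟨D * C * C, by positivity, fun t u => ?_⟩
    have hD' := hD (t - u)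
    rw [zero_mul, Real.exp_zero, mul_one] at hD'
    simp only [hfdef]
    rw [norm_mul, norm_mul, norm_mul, norm_pow, Complex.norm_real, Complex.norm_real,
      Complex.norm_real, mul_comm Complex.I, Complex.norm_exp_ofReal_mul_I, mul_one,
      Real.norm_eq_abs, Real.norm_eq_abs, Real.norm_eq_abs]
    calc |t - u| ^ (2 * n) * |φ t| * |φ u| ≤ (D * Real.exp ((t - u) ^ 2)) *
          (C * Real.exp (-3 * t ^ 2)) * (C * Real.exp (-3 * u ^ 2)) := by
          refine mul_le_mul (mul_le_mul hD' (hC _) (abs_nonneg _) (by positivity)) (hC _)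
            (by positivity) (by positivity)
      _ = D * C * C * (Real.exp ((t - u) ^ 2) * Real.exp (-3 * t ^ 2) * Real.exp (-3 * u ^ 2)) := by
          ring
      _ ≤ _ := by
          rw [← Real.exp_add, ← Real.exp_add]
          gcongr
          nlinarith [sq_nonneg (t + u)]
  obtain ⟨C, hC0, hC⟩ := hfb
  have hfi := gauss2_integrable hf one_pos hC
  have e1 : Lag (fourierF φ) n (x : ℂ) = ((Nat.factorial (2 * n) : ℂ))⁻¹ * ∫ t, ∫ u, f t u := by
    have e2 : ∫ t, ∫ u, f t u = ∫ p : ℝ × ℝ, f p.1 p.2 := (integral_prod _ hfi).symm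
    rw [e2]
    unfold Lag
    have e3 : ∀ p : ℝ × ℝ, f p.1 p.2 = ∑ j ∈ Finset.range (2 * n + 1),
        ((-1 : ℂ) ^ (j + n) * (Nat.choose (2 * n) j)) *
          (mInt φ j x p.1 * mInt φ (2 * n - j) x p.2) := by
      rintro ⟨t, u⟩
      have b := add_pow (-(Complex.I * t)) (Complex.I * u) (2 * n)
      have hl : (-(Complex.I * t) + Complex.I * u) ^ (2 * n) =
          (-1) ^ n * ((t - u : ℝ) : ℂ) ^ (2 * n) := by
        have : -(Complex.I * t) + Complex.I * u = (-Complex.I) * ((t - u : ℝ) : ℂ) := by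
          push_cast; ring
        rw [this, mul_pow, pow_mul (-Complex.I)]
        simp
      rw [hl] at b
      have b' : ((t - u : ℝ) : ℂ) ^ (2 * n) = ∑ j ∈ Finset.range (2 * n + 1),
        ((-1 : ℂ) ^ (j + n) * (Nat.choose (2 * n) j)) *
          ((Complex.I * t) ^ j * (Complex.I * u) ^ (2 * n - j)) := by
        have h1 : ((-1 : ℂ) ^ n) * (-1) ^ n = 1 := by
          rw [← mul_pow]; simp
        calc ((t - u : ℝ) : ℂ) ^ (2 * n) = (-1) ^ n * ((-1) ^ n * ((t - u : ℝ) : ℂ) ^ (2 * n)) := by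
              rw [← mul_assoc, h1, one_mul]
          _ = _ := by
              rw [b, Finset.mul_sum]
              refine Finset.sum_congr rfl fun j _ => ?_
              rw [neg_pow (Complex.I * t), pow_add]
              ring
      simp only [hfdef, mInt]
      rw [b', Finset.sum_mul, Finset.sum_mul, Finset.sum_mul]
      refine Finset.sum_congr rfl fun j _ => ?_
      have : Complex.exp (Complex.I * ((t + u) * x : ℝ)) =
          Complex.exp (Complex.I * t * x) * Complex.exp (Complex.I * u * x) := by
        rw [← Complex.exp_add]; push_cast; ring_nf
      rw [this]
      ring
    simp_rw [e3]
    rw [Measure.volume_eq_prod, integral_finsetSum _ fun j _ =>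
      (((mInt_integrable hφ j x).mul_prod (mInt_integrable hφ (2 * n - j) x)).const_mul _),
      Finset.mul_sum]
    refine Finset.sum_congr rfl fun j _ => ?_
    rw [integral_const_mul]
    have := integral_prod_mul (μ := volume) (ν := volume) (mInt φ j x) (mInt φ (2 * n - j) x)
    rw [show (∫ p : ℝ × ℝ, mInt φ j x p.1 * mInt φ (2 * n - j) x p.2 ∂(volume.prod volume)) = _ from this,
      fourierF_iter hφ, fourierF_iter hφ]
    ring
  rw [e1, change_vars hf hC0 one_pos hC]
  have e4 : ∀ v : ℝ, ∫ s, f (s + v) (v - s) = 2 ^ (2 * n) *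
      ((assocKernel φ n v : ℂ) * Complex.exp (Complex.I * (2 * v * x : ℝ))) := by
    intro v
    unfold assocKernel
    rw [← integral_complex_ofReal, ← integral_mul_const, ← integral_const_mul]
    refine integral_congr_ae (Filter.Eventually.of_forall fun s => ?_)
    simp only [hfdef]
    rw [show φ (v - s) = φ (s - v) by rw [← heven]; ring_nf,
      show s + v - (v - s) = 2 * s by ring, show s + v + (v - s) = 2 * v by ring]
    push_cast
    rw [mul_pow]
    ring
  simp_rw [e4]
  rw [integral_const_mul, assoc_exp_cos (assoc_int hφ n) (assoc_even φ n) x]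
  push_cast
  ring

end PartB2

section PartB3
open MeasureTheory Filter Complex Real
open scoped Topology FourierTransform RealInnerProductSpace

lemma tendsto_gauss_fourier {f : ℝ → ℂ} (hf : Integrable f) (hc : Continuous f) (v : ℝ) :
    Tendsto (fun (c : ℝ) ↦ (∫ w : ℝ, cexp (- c⁻¹ * ‖w‖ ^ 2 + 2 * π * I * ⟪v, w⟫)
       • (𝓕 f) w)) atTop (𝓝 (f v)) := by
  refine (tendsto_integral_gaussian_smul' hf hc.continuousAt).congr' ?_
  filter_upwards [Ioi_mem_atTop 0] with c (hc : 0 < c)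
  have J : Integrable (fun w : ℝ ↦ cexp (- c⁻¹ * ‖w‖ ^ 2 + 2 * π * I * ⟪v, w⟫)) :=
    GaussianFourier.integrable_cexp_neg_mul_sq_norm_add (by simpa) _ _
  have h1 : ∫ w : ℝ, cexp (- c⁻¹ * ‖w‖ ^ 2 + 2 * π * I * ⟪v, w⟫) • (𝓕 f) w =
      ∫ w : ℝ, 𝓕 (fun w : ℝ ↦ cexp (- c⁻¹ * ‖w‖ ^ 2 + 2 * π * I * ⟪v, w⟫)) w • f w := by
    simpa using! (VectorFourier.integral_fourierIntegral_smul_eq_flip (L := innerₗ ℝ)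
      Real.continuous_fourierChar continuous_inner J hf).symm
  rw [h1]
  congr with w
  rw [fourier_gaussian_innerProductSpace' (by simpa)]
  congr 2
  · simp
  · congr 1
    simp only [ofReal_inv, div_eq_mul_inv, inv_inv]
    ring

lemma posDef_of_fourier_nonneg {k : ℝ → ℝ} (hk : Integrable k) (hc : Continuous k)
    (r : ℝ → ℝ) (hr : ∀ w, 0 ≤ r w) (hkr : ∀ w, 𝓕 (fun t => (k t : ℂ)) w = (r w : ℂ)) :
    PosDefKernel k := by
  refine ⟨hc, fun n x ρ => ?_⟩
  have hkc : Continuous (fun t => (k t : ℂ)) := by fun_prop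
  have hT : Tendsto (fun c : ℝ => ∑ i, ∑ j, (∫ w : ℝ,
      cexp (- c⁻¹ * ‖w‖ ^ 2 + 2 * π * I * ⟪x i - x j, w⟫) • (𝓕 (fun t => (k t : ℂ))) w) * ρ i *
      (starRingEnd ℂ) (ρ j)) atTop
      (𝓝 (∑ i, ∑ j, (k (x i - x j) : ℂ) * ρ i * (starRingEnd ℂ) (ρ j))) := by
    refine tendsto_finsetSum _ fun i _ => tendsto_finsetSum _ fun j _ => ?_
    exact ((tendsto_gauss_fourier hk.ofReal hkc (x i - x j)).mul_const _).mul_const _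
  refine ge_of_tendsto hT ?_
  filter_upwards [Ioi_mem_atTop 0] with c (hc0 : 0 < c)
  have hi : ∀ i j, Integrable fun w : ℝ =>
      cexp (- c⁻¹ * ‖w‖ ^ 2 + 2 * π * I * ⟪x i - x j, w⟫) • (𝓕 (fun t => (k t : ℂ))) w := by
    intro i j
    have J : Integrable (fun w : ℝ ↦ cexp (- c⁻¹ * ‖w‖ ^ 2 + 2 * π * I * ⟪x i - x j, w⟫)) :=
      GaussianFourier.integrable_cexp_neg_mul_sq_norm_add (by simpa) _ _
    have hFc : Continuous (𝓕 (fun t => (k t : ℂ))) :=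
      VectorFourier.fourierIntegral_continuous Real.continuous_fourierChar
        continuous_inner hk.ofReal
    refine J.mul_bdd (c := ∫ t, ‖(k t : ℂ)‖) hFc.aestronglyMeasurable
      (Eventually.of_forall fun w => ?_)
    exact VectorFourier.norm_fourierIntegral_le_integral_norm _ _ _ _ w
  have hi2 : ∀ i j, Integrable fun w : ℝ =>
      cexp (- c⁻¹ * ‖w‖ ^ 2 + 2 * π * I * ⟪x i - x j, w⟫) • (𝓕 (fun t => (k t : ℂ))) w * ρ i *
      (starRingEnd ℂ) (ρ j) := fun i j => ((hi i j).mul_const _).mul_const _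
  have h1 : ∑ i, ∑ j, (∫ w : ℝ,
      cexp (- c⁻¹ * ‖w‖ ^ 2 + 2 * π * I * ⟪x i - x j, w⟫) • (𝓕 (fun t => (k t : ℂ))) w) * ρ i *
      (starRingEnd ℂ) (ρ j) = ∫ w : ℝ, ((Real.exp (-c⁻¹ * w ^ 2) * r w *
        Complex.normSq (∑ i, ρ i * cexp (2 * π * I * (x i * w))) : ℝ) : ℂ) := by
    simp_rw [← integral_mul_const]
    simp_rw [← integral_finsetSum _ fun j _ => hi2 _ j]
    rw [← integral_finsetSum _ fun i _ => integrable_finsetSum _ fun j _ => hi2 i j]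
    refine integral_congr_ae (Eventually.of_forall fun w => ?_)
    simp only
    rw [ofReal_mul, ofReal_mul, Complex.normSq_eq_conj_mul_self, mul_comm ((starRingEnd ℂ) _),
      map_sum, Finset.sum_mul_sum, Finset.mul_sum]
    refine Finset.sum_congr rfl fun i _ => ?_
    rw [Finset.mul_sum]
    refine Finset.sum_congr rfl fun j _ => ?_
    have : cexp (- c⁻¹ * ‖w‖ ^ 2 + 2 * π * I * ⟪x i - x j, w⟫) = (Real.exp (-c⁻¹ * w ^ 2) : ℂ) *
        cexp (2 * π * I * (x i * w)) * (starRingEnd ℂ) (cexp (2 * π * I * (x j * w))) := by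
      rw [← Complex.exp_conj, Complex.ofReal_exp, ← Complex.exp_add, ← Complex.exp_add]
      congr 1
      have h2 : ((‖w‖ : ℝ) : ℂ) ^ 2 = (w : ℂ) ^ 2 := by
        rw [Real.norm_eq_abs]; norm_cast; rw [sq_abs]
      rw [h2]
      simp [Complex.conj_ofNat]
      ring
    rw [this, hkr, smul_eq_mul, map_mul]
    ring
  rw [h1, integral_complex_ofReal]
  refine ofReal_nonneg' (integral_nonneg fun w => ?_)
  have := hr w
  have := Complex.normSq_nonneg (∑ i, ρ i * cexp (2 * π * I * (x i * w)))
  positivity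

lemma posDef_of_cos {k : ℝ → ℝ} (hk : Integrable k) (hc : Continuous k) (he : ∀ t, k (-t) = k t)
    (h : ∀ x : ℝ, 0 ≤ ∫ t, k t * Real.cos (2 * x * t)) : PosDefKernel k := by
  refine posDef_of_fourier_nonneg hk hc (fun w => ∫ t, k t * Real.cos (2 * (-π * w) * t))
    (fun w => h _) fun w => ?_
  rw [Real.fourier_real_eq_integral_exp_smul, ← assoc_exp_cos hk he]
  refine integral_congr_ae (Eventually.of_forall fun t => ?_)
  simp only [smul_eq_mul]
  rw [mul_comm]
  push_cast
  ring_nf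

end PartB3
section PartB4
open MeasureTheory Filter ProbabilityTheory
open scoped Topology NNReal

lemma gauss_diff_law (N : ℕ) (v : ℝ≥0) (i j : Fin N) (hij : i ≠ j) :
    (Measure.pi fun _ : Fin N => gaussianReal 0 v).map (fun ω => ω i - ω j) =
      gaussianReal 0 (v + v) := by
  have h := iIndepFun_pi (μ := fun _ : Fin N => gaussianReal 0 v) (X := fun _ x => x)
    (fun _ => aemeasurable_id)
  have h1 := (h.indepFun hij).comp (φ := id) (ψ := fun x : ℝ => -x) measurable_id measurable_neg
  have hm : ∀ i, (Measure.pi fun _ : Fin N => gaussianReal 0 v).map (fun ω => ω i) =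
      gaussianReal 0 v := fun i => (measurePreserving_eval _ i).map_eq
  have hm2 : (Measure.pi fun _ : Fin N => gaussianReal 0 v).map (fun ω => -ω j) =
      gaussianReal 0 v := by
    have : (fun ω : Fin N → ℝ => -ω j) = (fun x : ℝ => -x) ∘ (fun ω => ω j) := rfl
    rw [this, ← Measure.map_map (g := fun x : ℝ => -x) measurable_neg (measurable_pi_apply j), hm j,
      gaussianReal_map_neg, neg_zero]
  have := gaussianReal_add_gaussianReal_of_indepFun (P := Measure.pi fun _ : Fin N => gaussianReal 0 v)
    (X := fun ω => ω i) (Y := fun ω => - ω j) h1 (hm i) hm2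
  rw [add_zero] at this
  rw [← this]
  rfl

lemma gauss_int_nonneg {k : ℝ → ℝ} (hc : Continuous k) {B : ℝ} (hB : ∀ t, |k t| ≤ B)
    (hpd : ∀ (N : ℕ) (x : Fin N → ℝ), 0 ≤ ∑ i, ∑ j, k (x i - x j)) (v : ℝ≥0) :
    0 ≤ ∫ t, k t ∂(gaussianReal 0 (v + v)) := by
  set E := ∫ t, k t ∂(gaussianReal 0 (v + v)) with hE
  have key : ∀ N : ℕ, 0 ≤ N * k 0 + N * (N - 1) * E := by
    intro N
    set P := Measure.pi fun _ : Fin N => gaussianReal 0 v with hP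
    have hi : ∀ i j : Fin N, Integrable (fun ω => k (ω i - ω j)) P := by
      intro i j
      refine (integrable_const B).mono' (Continuous.aestronglyMeasurable (by fun_prop))
        (Eventually.of_forall fun ω => hB _)
    have h1 : 0 ≤ ∫ ω, ∑ i, ∑ j, k (ω i - ω j) ∂P := integral_nonneg fun ω => hpd N ω
    rw [integral_finsetSum _ fun i _ => integrable_finsetSum _ fun j _ => hi i j] at h1
    simp_rw [integral_finsetSum _ fun j _ => hi _ j] at h1
    have h2 : ∀ i j : Fin N, ∫ ω, k (ω i - ω j) ∂P = E + if i = j then k 0 - E else 0 := by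
      intro i j
      split_ifs with h
      · subst h
        simp
      · rw [add_zero, hE, ← gauss_diff_law N v i j h,
          integral_map (by fun_prop) hc.aestronglyMeasurable]
    simp_rw [h2] at h1
    simp [Finset.sum_add_distrib] at h1
    linarith
  by_contra! hneg
  obtain ⟨N, hN⟩ := exists_nat_gt (k 0 / (-E) + 1)
  have hk0 : 0 ≤ k 0 := by simpa using hpd 1 (fun _ => 0)
  have hN1 : k 0 < (N - 1) * (-E) := by
    rw [← div_lt_iff₀ (by linarith)]; linarith
  have hNpos : (0 : ℝ) < N := by
    have : 0 ≤ k 0 / (-E) := div_nonneg hk0 (by linarith)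
    linarith
  nlinarith [key N]

lemma integral_nonneg_of_pd {k : ℝ → ℝ} (hc : Continuous k) (hk : Integrable k) {B : ℝ}
    (hB : ∀ t, |k t| ≤ B)
    (hpd : ∀ (N : ℕ) (x : Fin N → ℝ), 0 ≤ ∑ i, ∑ j, k (x i - x j)) :
    0 ≤ ∫ t, k t := by
  have h1 : ∀ m : ℕ, 0 ≤ ∫ t, Real.exp (-t ^ 2 / (4 * (m + 1))) * k t := by
    intro m
    have h := gauss_int_nonneg hc hB hpd ((m : ℝ≥0) + 1)
    have hv : ((m : ℝ≥0) + 1 + (m + 1)) ≠ 0 := by positivity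
    rw [integral_gaussianReal_eq_integral_smul hv] at h
    simp only [gaussianPDFReal, smul_eq_mul, mul_assoc] at h
    rw [integral_const_mul] at h
    have hpos : 0 < (√(2 * (Real.pi * ((m : ℝ≥0) + 1 + (m + 1) : ℝ≥0))))⁻¹ := by
      have : (0 : ℝ) < ((m : ℝ≥0) + 1 + (m + 1) : ℝ≥0) := by positivity
      positivity
    have h' := nonneg_of_mul_nonneg_right h hpos
    refine le_of_le_of_eq h' (integral_congr_ae (Eventually.of_forall fun t => ?_))
    simp only [sub_zero]
    congr 3
    push_cast
    ring
  have h2 : Tendsto (fun m : ℕ => ∫ t, Real.exp (-t ^ 2 / (4 * (m + 1))) * k t) atTop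
      (𝓝 (∫ t, k t)) := by
    refine tendsto_integral_of_dominated_convergence (fun t => ‖k t‖)
      (fun m => Continuous.aestronglyMeasurable (by fun_prop)) hk.norm
      (fun m => Eventually.of_forall fun t => ?_) (Eventually.of_forall fun t => ?_)
    · rw [norm_mul]
      refine mul_le_of_le_one_left (norm_nonneg _) ?_
      rw [Real.norm_eq_abs, Real.abs_exp, Real.exp_le_one_iff]
      apply div_nonpos_of_nonpos_of_nonneg
      · nlinarith [sq_nonneg t]
      · positivity
    · have h3 : Tendsto (fun m : ℕ => -t ^ 2 / 4 * (1 / ((m : ℝ) + 1))) atTop (𝓝 (-t ^ 2 / 4 * 0)) :=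
        tendsto_one_div_add_atTop_nhds_zero_nat.const_mul _
      have h4 := ((Real.continuous_exp.tendsto _).comp h3).mul_const (k t)
      simp only [mul_zero, Real.exp_zero, one_mul, Function.comp_def] at h4
      refine h4.congr fun m => ?_
      congr 2
      field_simp
  exact ge_of_tendsto' h2 h1

lemma cos_nonneg_of_posDef {k : ℝ → ℝ} (hk : Integrable k) {B : ℝ} (hB : ∀ t, |k t| ≤ B)
    (hpd : PosDefKernel k) (x : ℝ) : 0 ≤ ∫ t, k t * Real.cos (2 * x * t) := by
  have hc := hpd.1
  have hB' : ∀ t, |k t * Real.cos (2 * x * t)| ≤ B := fun t => by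
    rw [abs_mul]
    exact (mul_le_of_le_one_right (abs_nonneg _) (Real.abs_cos_le_one _)).trans (hB t)
  refine integral_nonneg_of_pd (by fun_prop) ?_ hB' fun N y => ?_
  · refine hk.mul_bdd (c := 1) (Continuous.aestronglyMeasurable (by fun_prop))
      (Eventually.of_forall fun t => Real.abs_cos_le_one _)
  · have h := hpd.2 N y (fun j => Complex.exp (((2 * x * y j : ℝ) : ℂ) * Complex.I))
    have h' := (Complex.le_def.1 h).1
    simp only [Complex.zero_re, Complex.re_sum] at h'
    refine le_of_le_of_eq h' (Finset.sum_congr rfl fun i _ => Finset.sum_congr rfl fun j _ => ?_)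
    rw [← Complex.exp_conj, mul_assoc, ← Complex.exp_add, Complex.re_ofReal_mul, map_mul,
      Complex.conj_I, Complex.conj_ofReal]
    congr 1
    rw [← Complex.exp_ofReal_mul_I_re]
    congr 2
    push_cast
    ring

end PartB4
lemma thm_aux (φ : ℝ → ℝ) (hφ : AdmissibleKernel φ) :
    (∀ (n : ℕ) (x : ℝ),
      Lag (fourierF φ) n (x : ℂ) =
        ((2 * 2 ^ (2 * n) / (Nat.factorial (2 * n)) *
          ∫ t : ℝ, assocKernel φ n t * Real.cos (2 * x * t) : ℝ) : ℂ)) ∧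
    ((∀ z : ℂ, fourierF φ z = 0 → z.im = 0) ↔
      ∀ n : ℕ, PosDefKernel (assocKernel φ n)) := by
  obtain ⟨hs, hpos, heven, -, ε, hε, hO⟩ := hφ
  have hSG : SG φ := SG_of_isBigO hs.continuous hε (by simpa using hO 0)
  have hform := lag_formula hSG heven
  have hF0 := fourierF_zero hSG hpos
  refine ⟨hform, fun hz n => ?_, fun hpd z hz => ?_⟩
  · refine posDef_of_cos (assoc_int hSG n) (assoc_cont hSG n) (assoc_even φ n) fun x => ?_
    have h := lag_nonneg_of_real_zeros (fourierF_diff hSG) hF0.1 hF0.2 (fourierF_conj heven) hz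
      (fourierF_grow hSG) n x
    rw [hform n x] at h
    have h' : 0 ≤ 2 * 2 ^ (2 * n) / (Nat.factorial (2 * n) : ℝ) *
          ∫ t : ℝ, assocKernel φ n t * Real.cos (2 * x * t) := by exact_mod_cast h
    exact nonneg_of_mul_nonneg_right h' (by positivity)
  · refine real_zeros_of_lag_nonneg (fourierF_diff hSG) ?_ (fourierF_conj heven)
      (fun n x => ?_) z hz
    · rw [hF0.1]
      exact_mod_cast hF0.2.ne'
    · rw [hform n x]
      refine ofReal_nonneg' (mul_nonneg (by positivity) ?_)
      obtain ⟨C, hC0, hC⟩ := assoc_decay hSG n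
      refine cos_nonneg_of_posDef (assoc_int hSG n) (B := C) (fun t => ?_) (hpd n) x
      refine (hC t).trans (mul_le_of_le_one_right hC0 ?_)
      rw [Real.exp_le_one_iff]
      nlinarith [sq_nonneg t]

/-- **Theorem 3.7.** Let `φ` be an admissible kernel with `log φ` strictly concave on
`(0, ∞)`, let `Kₙ` be the associated kernels, and let `F(x) := ∫ e^{itx}·φ(t) dt`.  Then
`Lₙ(x; F) = (2·2^{2n}/(2n)!)·∫ Kₙ(t)·cos(2xt) dt` for every `n ∈ ℕ₀` and `x ∈ ℝ`, and
`F` has only real zeros (i.e. `F ∈ 𝓛-𝓟`) if and only if `Kₙ` is positive definite for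
every `n ∈ ℕ₀`. -/
theorem thm_3_7 (φ : ℝ → ℝ) (hφ : AdmissibleKernel φ)
    (hconc : ∀ t : ℝ, 0 < t → iteratedDeriv 2 (fun u => Real.log (φ u)) t < 0) :
    (∀ (n : ℕ) (x : ℝ),
      Lag (fourierF φ) n (x : ℂ) =
        ((2 * 2 ^ (2 * n) / (Nat.factorial (2 * n)) *
          ∫ t : ℝ, assocKernel φ n t * Real.cos (2 * x * t) : ℝ) : ℂ)) ∧
    ((∀ z : ℂ, fourierF φ z = 0 → z.im = 0) ↔
      ∀ n : ℕ, PosDefKernel (assocKernel φ n)) := by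
  exact thm_aux φ hφ
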